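/- Let f : F_2 × F_2 → {±1} be defined by f(x,y) = (−1)^{x+y+1}, let H be a finite simple graph of odd girth k, let α ∈ (0,1), and let 0 < ε < 1 − α. Writing c_k(H) for the number of edge sets S ⊆ E(H) that form a cycle of length k, we have t_H(α + εf) ≤ α^{e(H)} − ε^k α^{e(H)−k} c_k(H) + 2^{e(H)} ε^{k+1}. -/

import Mathlib

open Finset SimpleGraph

noncomputable section

/-- `f(x,y) = (-1)^(x+y+1)`, identifying elements of `F₂` with `0` and `1`. -/
def fWitness : ZMod 2 → ZMod 2 → ℝ := fun x y => (-1) ^ (x.val + y.val + 1)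

/-- The ordered-pair representatives `(v, w)` with `v < w` of the edges in `S`. -/
def edgePairs {V : Type} [Fintype V] [LinearOrder V] (S : Finset (Sym2 V)) :
    Finset (V × V) :=
  Finset.univ.filter fun p : V × V => p.1 < p.2 ∧ s(p.1, p.2) ∈ S

/-- `E_{x ∈ F₂^V} ∏_{vw ∈ S} g (x v) (x w)`, the expectation taken with respect to the
uniform measure on `F₂^V`. -/
def edgeExpect {V : Type} [Fintype V] [LinearOrder V] (S : Finset (Sym2 V))
    (g : ZMod 2 → ZMod 2 → ℝ) : ℝ :=
  (∑ x : V → ZMod 2, ∏ p ∈ edgePairs S, g (x p.1) (x p.2)) / 2 ^ Fintype.card V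

/-- The homomorphism density `t_H(g)` of `H` in `g : F₂ × F₂ → ℝ`. -/
def homDensity {V : Type} [Fintype V] [LinearOrder V] (H : SimpleGraph V)
    [DecidableRel H.Adj] (g : ZMod 2 → ZMod 2 → ℝ) : ℝ :=
  edgeExpect H.edgeFinset g

/-- `S` is exactly the edge set of a cycle of length `k` in `H`. -/
def IsCycleEdgeSet {V : Type} [DecidableEq V] (H : SimpleGraph V) (k : ℕ) (S : Finset (Sym2 V)) : Prop :=
  ∃ (u : V) (w : H.Walk u u), w.IsCycle ∧ w.length = k ∧ S = w.edges.toFinset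

/-- The number of edge sets `S ⊆ E(H)` forming a cycle of length `k` in `H`. -/
def cycleCount {V : Type} [DecidableEq V] (H : SimpleGraph V) (k : ℕ) : ℕ :=
  Nat.card {S : Finset (Sym2 V) // IsCycleEdgeSet H k S}

/-- `H` is isomorphic to a cycle graph. -/
def IsCycleGraph {V : Type} (H : SimpleGraph V) : Prop :=
  ∃ n : ℕ, Nonempty (H ≃g cycleGraph n)

end

theorem fWitness_eq (a b : ZMod 2) : fWitness a b = if a = b then -1 else 1 := by
  unfold fWitness
  have h2 : ∀ a b : ZMod 2, (a = b ∧ Odd (a.val + b.val + 1)) ∨ (a ≠ b ∧ Even (a.val + b.val + 1)) := by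
    decide
  rcases h2 a b with ⟨h, h'⟩ | ⟨h, h'⟩
  · rw [h'.neg_one_pow, if_pos h]
  · rw [h'.neg_one_pow, if_neg h]

theorem fWitness_comm (a b : ZMod 2) : fWitness a b = fWitness b a := by
  simp only [fWitness_eq, eq_comm]

theorem fWitness_abs (a b : ZMod 2) : |fWitness a b| = 1 := by
  rw [fWitness_eq]; split_ifs <;> simp

theorem fWitness_shift (a b c : ZMod 2) : fWitness (a + c) (b + c) = fWitness a b := by
  simp only [fWitness_eq, add_left_inj]

theorem fWitness_flip (a b : ZMod 2) : fWitness (a + 1) b = - fWitness a b := by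
  have h2 : ∀ a b : ZMod 2, (a + 1 = b ↔ a ≠ b) := by decide
  simp only [fWitness_eq, h2]
  by_cases h : a = b <;> simp [h]

theorem fWitness_mul (a b c : ZMod 2) : fWitness a b * fWitness b c = - fWitness a c := by
  have h2 : ∀ a b c : ZMod 2, (a = c ↔ (a = b ↔ b = c)) := by decide
  simp only [fWitness_eq, h2 a b c]
  by_cases h : a = b <;> by_cases h' : b = c <;> simp [h, h']

/-- The edge weight as a function on unordered pairs. -/
noncomputable def edgeF {V : Type} (x : V → ZMod 2) : Sym2 V → ℝ :=
  Sym2.lift ⟨fun u v => fWitness (x u) (x v), fun _ _ => fWitness_comm _ _⟩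

theorem edgeF_mk {V : Type} (x : V → ZMod 2) (u v : V) :
    edgeF x s(u, v) = fWitness (x u) (x v) := rfl

theorem edgeF_abs {V : Type} (x : V → ZMod 2) (e : Sym2 V) : |edgeF x e| = 1 := by
  induction e with | _ u v => exact fWitness_abs _ _

theorem prod_edgePairs {V : Type} [Fintype V] [LinearOrder V] (S : Finset (Sym2 V))
    (hS : ∀ e ∈ S, ¬ e.IsDiag) (G : Sym2 V → ℝ) :
    ∏ p ∈ edgePairs S, G s(p.1, p.2) = ∏ e ∈ S, G e := by
  refine Finset.prod_bij (fun p _ => s(p.1, p.2)) ?_ ?_ ?_ ?_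
  · intro p hp
    simp only [edgePairs, Finset.mem_filter] at hp
    exact hp.2.2
  · rintro ⟨a, b⟩ hp ⟨c, d⟩ hq h
    simp only [edgePairs, Finset.mem_filter] at hp hq
    rcases Sym2.eq_iff.1 h with ⟨h1, h2⟩ | ⟨h1, h2⟩
    · simp only at h1 h2; rw [h1, h2]
    · simp only at h1 h2
      subst h1 h2
      exact absurd hp.2.1 (not_lt.2 hq.2.1.le)
  · intro e he
    induction e with | _ u v =>
    have hd := hS _ he
    rw [Sym2.mk_isDiag_iff] at hd
    rcases lt_or_gt_of_ne hd with h | h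
    · exact ⟨(u, v), by simp [edgePairs, h, he], rfl⟩
    · exact ⟨(v, u), by simp [edgePairs, h, Sym2.eq_swap, he], Sym2.eq_swap⟩
  · intros; rfl

theorem walk_prod {V : Type} {H : SimpleGraph V} (x : V → ZMod 2) {u v : V} (w : H.Walk u v) :
    (w.edges.map (edgeF x)).prod = (-1) ^ (w.length + 1) * fWitness (x u) (x v) := by
  induction w with
  | nil => simp [fWitness_eq]
  | @cons a b c h p ih =>
    rw [Walk.edges_cons, List.map_cons, List.prod_cons, ih, edgeF_mk, Walk.length_cons,
      mul_left_comm, fWitness_mul]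
    ring

theorem cycle_prod {V : Type} [DecidableEq V] {H : SimpleGraph V} {k : ℕ} (hodd : Odd k)
    {S : Finset (Sym2 V)} (hS : IsCycleEdgeSet H k S) (x : V → ZMod 2) :
    ∏ e ∈ S, edgeF x e = -1 := by
  obtain ⟨u, w, hw, hl, rfl⟩ := hS
  rw [List.prod_toFinset _ hw.edges_nodup, walk_prod, hl, hodd.add_one.neg_one_pow, fWitness_eq]
  simp

theorem cycle_card {V : Type} [DecidableEq V] {H : SimpleGraph V} {k : ℕ}
    {S : Finset (Sym2 V)} (hS : IsCycleEdgeSet H k S) : S.card = k := by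
  obtain ⟨u, w, hw, hl, rfl⟩ := hS
  rw [List.toFinset_card_of_nodup hw.edges_nodup, Walk.length_edges, hl]

theorem sum_acyclic {V : Type} [Fintype V] [DecidableEq V] (S : Finset (Sym2 V))
    (hS : ∀ e ∈ S, ¬ e.IsDiag) (hne : S.Nonempty)
    (hac : (fromEdgeSet (S : Set (Sym2 V))).IsAcyclic) :
    ∑ x : V → ZMod 2, ∏ e ∈ S, edgeF x e = 0 := by
  classical
  obtain ⟨e, he⟩ := hne
  induction e with | _ u v =>
  have huv : u ≠ v := fun h => hS _ he (by simpa using h)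
  have hbr := isBridge_iff.1 (isAcyclic_iff_forall_adj_isBridge.1 hac
    ((fromEdgeSet_adj _).2 ⟨by simpa using he, huv⟩))
  set G' := (fromEdgeSet (S : Set (Sym2 V))).deleteEdges {s(u, v)} with hG'
  let δ : V → ZMod 2 := fun z => if G'.Reachable u z then 1 else 0
  have key : ∀ x : V → ZMod 2, ∏ e ∈ S, edgeF (x + δ) e = - ∏ e ∈ S, edgeF x e := by
    intro x
    rw [← Finset.mul_prod_erase S _ he, ← Finset.mul_prod_erase S (edgeF x) he, ← neg_mul]
    congr 1
    · have h1 : δ u = 1 := by simp [δ]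
      have h2 : δ v = 0 := by simp [δ, hbr]
      simp only [edgeF_mk, Pi.add_apply, h1, h2, add_zero, fWitness_flip]
    · refine Finset.prod_congr rfl fun e' he' => ?_
      rw [Finset.mem_erase] at he'
      induction e' with | _ a b =>
      have hab : a ≠ b := fun h => hS _ he'.2 (by simpa using h)
      have hadj : G'.Adj a b := by
        rw [hG', deleteEdges_adj, fromEdgeSet_adj]
        exact ⟨⟨by simpa using he'.2, hab⟩, by simpa using he'.1⟩
      have : δ a = δ b := by
        have : G'.Reachable u a ↔ G'.Reachable u b :=
          ⟨fun h => h.trans hadj.reachable, fun h => h.trans hadj.symm.reachable⟩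
        simp only [δ, this]
      simp only [edgeF_mk, Pi.add_apply, this, fWitness_shift]
  have h := Equiv.sum_comp (Equiv.addRight δ) (fun x : V → ZMod 2 => ∏ e ∈ S, edgeF x e)
  simp only [Equiv.coe_addRight, key, Finset.sum_neg_distrib] at h
  linarith

theorem even_or_cycle {V : Type} [Fintype V] [DecidableEq V] (H : SimpleGraph V) {k : ℕ}
    (hgirth : H.egirth = k) (S : Finset (Sym2 V)) (hS : ∀ e ∈ S, e ∈ H.edgeSet)
    (hac : ¬ (fromEdgeSet (S : Set (Sym2 V))).IsAcyclic) :
    k + 1 ≤ S.card ∨ IsCycleEdgeSet H k S := by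
  simp only [IsAcyclic, not_forall, not_not] at hac
  obtain ⟨u, w, hw⟩ := hac
  have hle : fromEdgeSet (S : Set (Sym2 V)) ≤ H := by
    intro a b hab
    rw [fromEdgeSet_adj] at hab
    exact hS _ (by simpa using hab.1)
  have hk : k ≤ w.length := by
    have := egirth_le_length (hw.mapLe hle)
    rw [hgirth] at this
    simpa using this
  have hsub : w.edges.toFinset ⊆ S := by
    intro e he
    have := w.edges_subset_edgeSet (List.mem_toFinset.1 he)
    rw [edgeSet_fromEdgeSet] at this
    simpa using this.1
  have hcard : w.edges.toFinset.card = w.length := by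
    rw [List.toFinset_card_of_nodup hw.edges_nodup, Walk.length_edges]
  have h1 := Finset.card_le_card hsub
  by_cases h : k + 1 ≤ S.card
  · exact Or.inl h
  · right
    refine ⟨u, w.mapLe hle, hw.mapLe hle, ?_, ?_⟩
    · simp only [Walk.length_map]; omega
    · rw [Walk.edges_mapLe_eq_edges]
      exact (Finset.eq_of_subset_of_card_le hsub (by omega)).symm

theorem stmt7_upper_bound {V : Type} [Fintype V] [LinearOrder V] (H : SimpleGraph V) [DecidableRel H.Adj]
    (k : ℕ) (hgirth : H.egirth = k) (hodd : Odd k)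
    (α ε : ℝ) (hα : α ∈ Set.Ioo (0 : ℝ) 1) (hε : 0 < ε) (hε' : ε < 1 - α) :
    homDensity H (fun x y => α + ε * fWitness x y)
      ≤ α ^ H.edgeFinset.card - ε ^ k * α ^ (H.edgeFinset.card - k) * (cycleCount H k : ℝ)
          + 2 ^ H.edgeFinset.card * ε ^ (k + 1) := by
  classical
  obtain ⟨hα0, hα1⟩ := hα
  have hε1 : ε < 1 := by linarith
  have hk0 : 0 < k := hodd.pos
  set E := H.edgeFinset with hE
  have hmem : ∀ S ∈ E.powerset, ∀ e ∈ S, e ∈ H.edgeSet := fun S hS e he =>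
    mem_edgeFinset.1 (Finset.mem_powerset.1 hS he)
  have hdiag : ∀ S ∈ E.powerset, ∀ e ∈ S, ¬ e.IsDiag := fun S hS e he =>
    H.not_isDiag_of_mem_edgeSet (hmem S hS e he)
  set N : ℝ := 2 ^ Fintype.card V with hN
  have hN0 : 0 < N := by positivity
  have hcardx : (Finset.univ : Finset (V → ZMod 2)).card = 2 ^ Fintype.card V := by
    rw [Finset.card_univ, Fintype.card_fun, ZMod.card]
  let c : Finset (Sym2 V) → ℝ := fun S => (∑ x : V → ZMod 2, ∏ e ∈ S, edgeF x e) / N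
  have hconst : ∀ r : ℝ, (∑ _x : V → ZMod 2, r) / N = r := by
    intro r
    rw [Finset.sum_const, hcardx, nsmul_eq_mul, hN]
    push_cast
    field_simp
  have hexp : homDensity H (fun x y => α + ε * fWitness x y)
      = ∑ S ∈ E.powerset, c S * (ε ^ S.card * α ^ (E.card - S.card)) := by
    have h1 : ∀ x : V → ZMod 2, ∏ p ∈ edgePairs E, (α + ε * fWitness (x p.1) (x p.2))
        = ∑ S ∈ E.powerset, (∏ e ∈ S, edgeF x e) * (ε ^ S.card * α ^ (E.card - S.card)) := by
      intro x
      have := prod_edgePairs E (hdiag E (Finset.mem_powerset_self _)) (fun e => ε * edgeF x e + α)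
      simp only [edgeF_mk] at this
      simp only [add_comm α]
      rw [this, Finset.prod_add]
      refine Finset.sum_congr rfl fun S hS => ?_
      rw [Finset.prod_mul_distrib, Finset.prod_const, Finset.prod_const,
        Finset.card_sdiff_of_subset (Finset.mem_powerset.1 hS)]
      ring
    unfold homDensity edgeExpect
    rw [← hE]
    simp only [h1]
    rw [Finset.sum_comm, Finset.sum_div]
    refine Finset.sum_congr rfl fun S _ => ?_
    rw [← Finset.sum_mul, mul_div_right_comm]
  have hcabs : ∀ S, c S ≤ 1 := by
    intro S
    rw [← hconst 1]
    refine div_le_div_of_nonneg_right (Finset.sum_le_sum fun x _ => ?_) hN0.le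
    refine (le_abs_self _).trans ?_
    rw [Finset.abs_prod]
    simp [edgeF_abs]
  have hterm : ∀ S ∈ E.powerset, c S * (ε ^ S.card * α ^ (E.card - S.card)) ≤
      (if S = ∅ then α ^ E.card else 0)
      - (if IsCycleEdgeSet H k S then ε ^ k * α ^ (E.card - k) else 0) + ε ^ (k + 1) := by
    intro S hS
    have hpos : 0 < ε ^ (k + 1) := by positivity
    by_cases hcyc : IsCycleEdgeSet H k S
    · have hcS : c S = -1 := by
        simp only [c, cycle_prod hodd hcyc]
        exact hconst _
      have hcard := cycle_card hcyc
      have hne : S ≠ ∅ := by rintro rfl; simp at hcard; omega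
      rw [if_neg hne, if_pos hcyc, hcS, hcard]
      linarith
    rw [if_neg hcyc]
    by_cases hne : S = ∅
    · subst hne
      have : c ∅ = 1 := by simp only [c, Finset.prod_empty]; exact hconst 1
      rw [this]; simp; positivity
    rw [if_neg hne]
    by_cases hac : (fromEdgeSet (S : Set (Sym2 V))).IsAcyclic
    · have : c S = 0 := by
        simp only [c]
        rw [sum_acyclic S (hdiag S hS) (Finset.nonempty_iff_ne_empty.2 hne) hac, zero_div]
      rw [this]; linarith
    · have hle := (even_or_cycle H hgirth S (hmem S hS) hac).resolve_right hcyc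
      have h1 : ε ^ S.card ≤ ε ^ (k + 1) := pow_le_pow_of_le_one hε.le hε1.le hle
      have h2 : α ^ (E.card - S.card) ≤ 1 := pow_le_one₀ hα0.le hα1.le
      have h3 : ε ^ S.card * α ^ (E.card - S.card) ≤ ε ^ (k + 1) :=
        (mul_le_of_le_one_right (by positivity) h2).trans h1
      have h4 := mul_le_mul_of_nonneg_right (hcabs S)
        (show 0 ≤ ε ^ S.card * α ^ (E.card - S.card) by positivity)
      linarith
  have hcount : (cycleCount H k : ℝ) = (E.powerset.filter (IsCycleEdgeSet H k)).card := by
    unfold cycleCount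
    rw [Nat.card_eq_fintype_card, Fintype.card_subtype]
    congr 2
    ext S
    simp only [Finset.mem_filter, Finset.mem_univ, true_and, Finset.mem_powerset]
    refine ⟨fun h => ⟨?_, h⟩, fun h => h.2⟩
    obtain ⟨u, w, hw, hl, rfl⟩ := h
    intro e he
    exact mem_edgeFinset.2 (w.edges_subset_edgeSet (List.mem_toFinset.1 he))
  rw [hexp]
  refine (Finset.sum_le_sum hterm).trans (le_of_eq ?_)
  rw [Finset.sum_add_distrib, Finset.sum_sub_distrib, Finset.sum_ite_eq',
    if_pos (Finset.empty_mem_powerset _), ← Finset.sum_filter, Finset.sum_const, Finset.sum_const,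
    Finset.card_powerset, hcount, nsmul_eq_mul, nsmul_eq_mul]
  push_cast
  ring
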